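/- Let r > 0. As ε → 0⁺, C₁₂(ε) + 2π (α̃(ε)/ξ₀(ε)) · [γ + log(√r) − log(√ε)] = O(ε), where γ is the Euler–Mascheroni constant. -/

import Mathlib

open Real Filter Topology

/-- The parameter α̃(ε) = √(ε(r + ε/4)) for two identical spheres of radius `r`. -/
noncomputable def alphaTilde (r ε : ℝ) : ℝ := Real.sqrt (ε * (r + ε / 4))

/-- The bispherical coordinate ξ₀(ε) = arsinh(α̃(ε)/r) of the sphere boundaries. -/
noncomputable def xi0 (r ε : ℝ) : ℝ := Real.arsinh (alphaTilde r ε / r)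

/-- The capacitance coefficient C₁₁ for two identical spheres of radius `r`. -/
noncomputable def C11sym (r ε : ℝ) : ℝ :=
  8 * π * alphaTilde r ε *
    ∑' n : ℕ, Real.exp ((2 * n + 1) * xi0 r ε) /
      (Real.exp (2 * (2 * n + 1) * xi0 r ε) - 1)

/-- The capacitance coefficient C₁₂ for two identical spheres of radius `r`. -/
noncomputable def C12sym (r ε : ℝ) : ℝ :=
  -(8 * π * alphaTilde r ε *
    ∑' n : ℕ, 1 / (Real.exp (2 * (2 * n + 1) * xi0 r ε) - 1))

/-- The Langevin function `coth u - 1 / u`. -/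
noncomputable def langevin (u : ℝ) : ℝ := cosh u / sinh u - 1 / u

/-- The primitive `log (sinh u / u)` of the Langevin function. -/
noncomputable def logSinhc (u : ℝ) : ℝ := log (sinh u / u)

/-- The derivative of the Langevin function for `u ≠ 0`, with an upper bound as value at `0`. -/
noncomputable def langevinDeriv (u : ℝ) : ℝ := if u = 0 then 1 else 1 / u ^ 2 - 1 / sinh u ^ 2

theorem nonneg_of_hasDerivAt_nonneg {f f' : ℝ → ℝ} (hf : ∀ x, HasDerivAt f (f' x) x)
    (h0 : f 0 = 0) (hf' : ∀ x, 0 ≤ x → 0 ≤ f' x) {x : ℝ} (hx : 0 ≤ x) : 0 ≤ f x := by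
  have hmono : MonotoneOn f (Set.Ici 0) := by
    refine monotoneOn_of_deriv_nonneg (convex_Ici 0)
      (fun y _ => (hf y).continuousAt.continuousWithinAt)
      (fun y _ => (hf y).differentiableAt.differentiableWithinAt) fun y hy => ?_
    rw [interior_Ici] at hy
    rw [(hf y).deriv]
    exact hf' y (le_of_lt hy)
  simpa [h0] using hmono (Set.self_mem_Ici) hx hx

theorem sinh_le_self_mul_cosh {u : ℝ} (hu : 0 ≤ u) : sinh u ≤ u * cosh u := by
  have h := nonneg_of_hasDerivAt_nonneg (f := fun x => x * cosh x - sinh x)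
    (f' := fun x => x * sinh x) (fun x => by
      have hderiv := ((hasDerivAt_id' x).mul (hasDerivAt_cosh x)).sub (hasDerivAt_sinh x)
      refine hderiv.congr_deriv ?_
      ring) (by simp) (fun x hx => mul_nonneg hx (sinh_nonneg_iff.2 hx)) hu
  linarith

theorem three_mul_le_sinh_mul_cosh {u : ℝ} (hu : 0 ≤ u) :
    0 ≤ 4 * (sinh u * cosh u) + 2 * (sinh u / cosh u ^ 3) - 6 * u := by
  refine nonneg_of_hasDerivAt_nonneg
    (f := fun x => 4 * (sinh x * cosh x) + 2 * (sinh x / cosh x ^ 3) - 6 * x)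
    (f' := fun x => 2 * (cosh x ^ 2 - 1) ^ 2 * (4 * cosh x ^ 2 + 3) / cosh x ^ 4)
    (fun x => ?_) (by simp) (fun x _ => by positivity) hu
  have hc : cosh x ≠ 0 := (cosh_pos x).ne'
  have hderiv := ((((hasDerivAt_sinh x).mul (hasDerivAt_cosh x)).const_mul 4).add
    (((hasDerivAt_sinh x).div ((hasDerivAt_cosh x).pow 3) (pow_ne_zero 3 hc)).const_mul 2)).sub
    ((hasDerivAt_id' x).const_mul 6)
  refine hderiv.congr_deriv ?_
  have hs : sinh x ^ 2 = cosh x ^ 2 - 1 := by rw [cosh_sq]; ring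
  field_simp
  simp only [Pi.pow_apply]
  norm_num
  linear_combination (4 * cosh x ^ 10 - 6 * cosh x ^ 6) * hs

theorem three_mul_sq_le_sinh_sq {u : ℝ} (hu : 0 ≤ u) :
    0 ≤ 2 * sinh u ^ 2 + 1 - 1 / cosh u ^ 2 - 3 * u ^ 2 := by
  refine nonneg_of_hasDerivAt_nonneg
    (f := fun x => 2 * sinh x ^ 2 + 1 - 1 / cosh x ^ 2 - 3 * x ^ 2)
    (f' := fun x => 4 * (sinh x * cosh x) + 2 * (sinh x / cosh x ^ 3) - 6 * x)
    (fun x => ?_) (by simp) (fun x hx => three_mul_le_sinh_mul_cosh hx) hu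
  have hc : cosh x ≠ 0 := (cosh_pos x).ne'
  have hderiv := (((((hasDerivAt_sinh x).pow 2).const_mul 2).add_const 1).sub
    ((hasDerivAt_const x (1 : ℝ)).div ((hasDerivAt_cosh x).pow 2) (pow_ne_zero 2 hc))).sub
    (((hasDerivAt_id' x).pow 2).const_mul 3)
  refine hderiv.congr_deriv ?_
  field_simp
  simp only [Pi.pow_apply]
  norm_num
  field_simp
  ring

/-- Lazarević's inequality. -/
theorem pow_three_mul_cosh_le_sinh_pow_three {u : ℝ} (hu : 0 ≤ u) :
    u ^ 3 * cosh u ≤ sinh u ^ 3 := by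
  have h := nonneg_of_hasDerivAt_nonneg (f := fun x => sinh x ^ 3 / cosh x - x ^ 3)
    (f' := fun x => 2 * sinh x ^ 2 + 1 - 1 / cosh x ^ 2 - 3 * x ^ 2) (fun x => by
      have hc : cosh x ≠ 0 := (cosh_pos x).ne'
      have hderiv := (((hasDerivAt_sinh x).pow 3).div (hasDerivAt_cosh x) hc).sub
        ((hasDerivAt_id' x).pow 3)
      refine hderiv.congr_deriv ?_
      have hs : sinh x ^ 2 = cosh x ^ 2 - 1 := by rw [cosh_sq]; ring
      field_simp
      simp only [Pi.pow_apply]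
      norm_num
      linear_combination (1 - sinh x ^ 2) * hs)
    (by simp) (fun x hx => three_mul_sq_le_sinh_sq hx) hu
  rw [← le_div_iff₀ (cosh_pos u)]
  linarith

theorem hasDerivAt_logSinhc {u : ℝ} (hu : 0 < u) : HasDerivAt logSinhc (langevin u) u := by
  have hs := sinh_pos_iff.2 hu
  have hderiv := ((hasDerivAt_sinh u).div (hasDerivAt_id' u) hu.ne').log (div_pos hs hu).ne'
  refine hderiv.congr_deriv ?_
  simp only [langevin, Pi.div_apply]
  field_simp

theorem hasDerivAt_langevin {u : ℝ} (hu : 0 < u) :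
    HasDerivAt langevin (langevinDeriv u) u := by
  have hs := sinh_pos_iff.2 hu
  have hderiv := ((hasDerivAt_cosh u).div (hasDerivAt_sinh u) hs.ne').sub
    ((hasDerivAt_const u (1 : ℝ)).div (hasDerivAt_id' u) hu.ne')
  refine hderiv.congr_deriv ?_
  rw [langevinDeriv, if_neg hu.ne', ← pow_two (cosh u), cosh_sq]
  field_simp
  ring

theorem continuousWithinAt_logSinhc_zero : ContinuousWithinAt logSinhc (Set.Ici 0) 0 := by
  have h : Tendsto (fun u => sinh u / u) (𝓝[≠] 0) (𝓝 1) := by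
    have := (hasDerivAt_sinh 0).tendsto_slope
    simpa [slope_fun_def, div_eq_inv_mul] using this
  have h' := h.log one_ne_zero
  rw [log_one] at h'
  have hc : ContinuousAt logSinhc 0 := by
    rw [continuousAt_iff_punctured_nhds]
    have h0 : logSinhc 0 = 0 := by simp [logSinhc]
    rw [h0]
    exact h'
  exact hc.continuousWithinAt

theorem continuousOn_logSinhc : ContinuousOn logSinhc (Set.Ici 0) := by
  intro u hu
  rcases eq_or_lt_of_le (Set.mem_Ici.1 hu) with rfl | h
  · exact continuousWithinAt_logSinhc_zero
  · exact (hasDerivAt_logSinhc h).continuousAt.continuousWithinAt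

theorem langevinDeriv_le_one {u : ℝ} (hu : 0 < u) : langevinDeriv u ≤ 1 := by
  have hs := sinh_pos_iff.2 hu
  have h := pow_le_pow_left₀ hs.le (sinh_le_self_mul_cosh hu.le) 2
  rw [mul_pow, cosh_sq] at h
  rw [langevinDeriv, if_neg hu.ne', div_sub_div _ _ (by positivity) (by positivity),
    div_le_one (by positivity)]
  linarith

theorem langevinDeriv_nonneg {u : ℝ} (hu : 0 ≤ u) : 0 ≤ langevinDeriv u := by
  rcases hu.eq_or_lt with rfl | hu
  · simp [langevinDeriv]
  rw [langevinDeriv, if_neg hu.ne', sub_nonneg]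
  have hs := self_le_sinh_iff.2 hu.le
  gcongr

theorem antitoneOn_langevinDeriv : AntitoneOn langevinDeriv (Set.Ici 0) := by
  have hd : ∀ u : ℝ, 0 < u →
      HasDerivAt langevinDeriv (2 * cosh u / sinh u ^ 3 - 2 / u ^ 3) u := by
    intro u hu
    have hs := sinh_pos_iff.2 hu
    have h : HasDerivAt (fun u => 1 / u ^ 2 - 1 / sinh u ^ 2)
        (2 * cosh u / sinh u ^ 3 - 2 / u ^ 3) u := by
      have hderiv := ((hasDerivAt_const u (1 : ℝ)).div ((hasDerivAt_id' u).pow 2)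
        (pow_ne_zero 2 hu.ne')).sub ((hasDerivAt_const u (1 : ℝ)).div
        ((hasDerivAt_sinh u).pow 2) (pow_ne_zero 2 hs.ne'))
      refine hderiv.congr_deriv ?_
      simp only [Pi.pow_apply]
      norm_num
      field_simp
      ring
    refine h.congr_of_eventuallyEq ?_
    filter_upwards [lt_mem_nhds hu] with v hv
    rw [langevinDeriv, if_neg (ne_of_gt hv)]
  have hanti : AntitoneOn langevinDeriv (Set.Ioi 0) := by
    refine antitoneOn_of_deriv_nonpos (convex_Ioi 0)
      (fun y hy => (hd y hy).continuousAt.continuousWithinAt)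
      (fun y hy => (hd y (by simpa using hy)).differentiableAt.differentiableWithinAt)
      fun y hy => ?_
    have hy : 0 < y := by simpa using hy
    have hs := sinh_pos_iff.2 hy
    rw [(hd y hy).deriv, sub_nonpos, div_le_div_iff₀ (by positivity) (by positivity)]
    linarith [pow_three_mul_cosh_le_sinh_pow_three hy.le]
  intro a ha b hb hab
  rcases eq_or_lt_of_le (Set.mem_Ici.1 ha) with rfl | ha'
  · rcases eq_or_lt_of_le (Set.mem_Ici.1 hb) with rfl | hb'
    · exact le_rfl
    · simpa [langevinDeriv] using langevinDeriv_le_one hb'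
  · exact hanti ha' (ha'.trans_le hab) hab

/-- Error of the midpoint rule for the Langevin function on `[m - d, m + d]`. -/
theorem abs_midpoint_langevin_le {m d : ℝ} (hd : 0 < d) (hm : d ≤ m) :
    |2 * d * langevin m - (logSinhc (m + d) - logSinhc (m - d))| ≤
      d ^ 2 * (langevinDeriv (m - d) - langevinDeriv (m + d)) := by
  set Δ := langevinDeriv (m - d) - langevinDeriv (m + d) with hΔ
  have hΔ0 : 0 ≤ Δ := sub_nonneg.2 <| antitoneOn_langevinDeriv
    (Set.mem_Ici.2 (by linarith)) (Set.mem_Ici.2 (by linarith)) (by linarith)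
  have hadd : ∀ t : ℝ, HasDerivAt (fun t => m + t) 1 t := fun t =>
    (hasDerivAt_id' t).const_add m
  have hsub : ∀ t : ℝ, HasDerivAt (fun t => m - t) (-1) t := fun t =>
    (hasDerivAt_id' t).const_sub m
  have hχ : ∀ t ∈ Set.Ico 0 d, ‖2 * langevin m - langevin (m + t) - langevin (m - t)‖ ≤ Δ * d := by
    intro t ht
    have hder : ∀ s ∈ Set.Icc 0 t,
        HasDerivAt (fun s => 2 * langevin m - langevin (m + s) - langevin (m - s))
          (langevinDeriv (m - s) - langevinDeriv (m + s)) s := by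
      intro s hs
      have h1 : 0 < m + s := by linarith [hs.1]
      have h2 : 0 < m - s := by linarith [hs.2, ht.2]
      have hderiv := (((hasDerivAt_langevin h1).comp s (hadd s)).const_sub (2 * langevin m)).sub
        ((hasDerivAt_langevin h2).comp s (hsub s))
      refine hderiv.congr_deriv ?_
      ring
    have hb := norm_image_sub_le_of_norm_deriv_le_segment' (C := Δ)
      (fun s hs => (hder s hs).hasDerivWithinAt) (fun s hs => by
        have h1 := antitoneOn_langevinDeriv (a := m - d) (b := m - s)
          (Set.mem_Ici.2 (by linarith)) (Set.mem_Ici.2 (by linarith [hs.2, ht.2]))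
          (by linarith [hs.2, ht.2])
        have h2 := antitoneOn_langevinDeriv (a := m + s) (b := m + d)
          (Set.mem_Ici.2 (by linarith [hs.1])) (Set.mem_Ici.2 (by linarith))
          (by linarith [hs.2, ht.2])
        have h3 := antitoneOn_langevinDeriv (a := m - s) (b := m + s)
          (Set.mem_Ici.2 (by linarith [hs.2, ht.2])) (Set.mem_Ici.2 (by linarith [hs.1]))
          (by linarith [hs.1])
        rw [norm_of_nonneg (sub_nonneg.2 h3)]
        linarith) t (Set.right_mem_Icc.2 ht.1)
    have h0 : 2 * langevin m - langevin (m + 0) - langevin (m - 0) = 0 := by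
      rw [add_zero, sub_zero]; ring
    rw [h0, sub_zero, sub_zero] at hb
    exact hb.trans (mul_le_mul_of_nonneg_left ht.2.le hΔ0)
  have hcont : ContinuousOn
      (fun t => 2 * t * langevin m - (logSinhc (m + t) - logSinhc (m - t))) (Set.Icc 0 d) := by
    refine ContinuousOn.sub (by fun_prop) (ContinuousOn.sub ?_ ?_)
    · exact continuousOn_logSinhc.comp (by fun_prop)
        (fun t ht => Set.mem_Ici.2 (by linarith [ht.1]))
    · exact continuousOn_logSinhc.comp (by fun_prop)
        (fun t ht => Set.mem_Ici.2 (by linarith [ht.2]))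
  have hb := norm_image_sub_le_of_norm_deriv_right_le_segment hcont
    (f' := fun t => 2 * langevin m - langevin (m + t) - langevin (m - t)) (C := Δ * d)
    (fun t ht => by
      have h1 : 0 < m + t := by linarith [ht.1]
      have h2 : 0 < m - t := by linarith [ht.2]
      have h : HasDerivAt
          (fun t => 2 * t * langevin m - (logSinhc (m + t) - logSinhc (m - t)))
          (2 * langevin m - langevin (m + t) - langevin (m - t)) t := by
        have hderiv := (((hasDerivAt_id' t).const_mul 2).mul_const (langevin m)).sub
          (((hasDerivAt_logSinhc h1).comp t (hadd t)).sub
            ((hasDerivAt_logSinhc h2).comp t (hsub t)))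
        refine hderiv.congr_deriv ?_
        ring
      exact h.hasDerivWithinAt) hχ d (Set.right_mem_Icc.2 hd.le)
  simp only [norm_eq_abs, mul_zero, zero_mul, add_zero, sub_zero, sub_self] at hb
  exact hb.trans_eq (by ring)

theorem abs_sum_langevin_sub_le {x : ℝ} (hx : 0 < x) (N : ℕ) :
    |2 * x * ∑ n ∈ Finset.range N, langevin ((2 * n + 1) * x) - logSinhc (2 * N * x)| ≤ x ^ 2 := by
  have key : ∀ N : ℕ,
      |2 * x * ∑ n ∈ Finset.range N, langevin ((2 * n + 1) * x) - logSinhc (2 * N * x)| ≤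
        x ^ 2 * (1 - langevinDeriv (2 * N * x)) := by
    intro N
    induction N with
    | zero => simp [logSinhc, langevinDeriv]
    | succ N ih =>
      have h := abs_midpoint_langevin_le (m := (2 * N + 1) * x) hx
        (by nlinarith [(Nat.cast_nonneg N : (0 : ℝ) ≤ N)])
      have e1 : (2 * (N : ℝ) + 1) * x - x = 2 * N * x := by ring
      have e2 : (2 * (N : ℝ) + 1) * x + x = 2 * ((N + 1 : ℕ) : ℝ) * x := by push_cast; ring
      rw [e1, e2] at h
      rw [Finset.sum_range_succ]
      refine (le_of_eq (congrArg _ ?_)).trans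
        ((abs_add_le _ _).trans ((add_le_add ih h).trans_eq ?_)) <;> ring
  refine (key N).trans ?_
  have := langevinDeriv_nonneg (u := 2 * N * x) (by positivity)
  nlinarith [sq_nonneg x]

theorem tendsto_sum_odd_sub_log :
    Tendsto (fun N : ℕ => ∑ n ∈ Finset.range N, 2 / (2 * (n : ℝ) + 1) - log N) atTop
      (𝓝 (eulerMascheroniConstant + 2 * log 2)) := by
  have hsum : ∀ N : ℕ, ∑ n ∈ Finset.range N, 2 / (2 * (n : ℝ) + 1) =
      2 * (harmonic (2 * N) : ℝ) - harmonic N := by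
    intro N
    induction N with
    | zero => simp
    | succ N ih =>
      rw [Finset.sum_range_succ, ih, show 2 * (N + 1) = 2 * N + 1 + 1 by ring,
        harmonic_succ, harmonic_succ, harmonic_succ]
      push_cast
      field_simp
      ring
  have h1 := tendsto_harmonic_sub_log
  have h2 := h1.comp (tendsto_id.const_mul_atTop' (show 0 < 2 by norm_num))
  have h3 := ((h2.const_mul 2).sub h1).add_const (2 * log 2)
  have e : 2 * eulerMascheroniConstant - eulerMascheroniConstant + 2 * log 2 =
      eulerMascheroniConstant + 2 * log 2 := by ring
  rw [e] at h3
  refine h3.congr' ?_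
  filter_upwards [eventually_gt_atTop 0] with N hN
  have hN' : (N : ℝ) ≠ 0 := by positivity
  simp only [Function.comp_apply, id_eq, hsum]
  rw [Nat.cast_mul, Nat.cast_ofNat, log_mul two_ne_zero hN']
  ring

theorem one_div_exp_sub_one_eq {u : ℝ} (hu : 0 < u) :
    1 / (exp (2 * u) - 1) = (langevin u + 1 / u - 1) / 2 := by
  have h1 : 1 < exp u := one_lt_exp_iff.2 hu
  have h2 : exp u ^ 2 - 1 ≠ 0 := by nlinarith
  rw [langevin, sinh_eq, cosh_eq, exp_neg, two_mul, exp_add]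
  have h3 : exp u - (exp u)⁻¹ ≠ 0 := by
    intro h
    field_simp at h
    exact h2 (by simpa using h)
  have h4 : exp u * exp u - 1 ≠ 0 := by rwa [← pow_two]
  field_simp
  ring

theorem summable_one_div_exp_sub_one {x : ℝ} (hx : 0 < x) :
    Summable fun n : ℕ => 1 / (exp (2 * (2 * n + 1) * x) - 1) := by
  have hq : exp (-(4 * x)) < 1 := exp_lt_one_iff.2 (by linarith)
  have hc : 0 < exp (2 * x) - 1 := sub_pos.2 (one_lt_exp_iff.2 (by linarith))
  refine Summable.of_nonneg_of_le (fun n => ?_) (fun n => ?_)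
    ((summable_geometric_of_lt_one (exp_pos _).le hq).mul_left (1 / (exp (2 * x) - 1)))
  · have : 1 ≤ exp (2 * (2 * n + 1) * x) := one_le_exp (by positivity)
    exact one_div_nonneg.2 (by linarith)
  · rw [← exp_nat_mul, mul_neg, exp_neg, ← one_div, one_div_mul_one_div]
    refine one_div_le_one_div_of_le (by positivity) ?_
    have e : exp (2 * (2 * n + 1) * x) = exp (2 * x) * exp (n * (4 * x)) := by
      rw [← exp_add]; ring_nf
    have : 1 ≤ exp (n * (4 * x)) := one_le_exp (by positivity)
    rw [e]
    linarith

theorem abs_tsum_one_div_exp_sub_one_sub_le {x : ℝ} (hx : 0 < x) :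
    |4 * x * ∑' n : ℕ, 1 / (exp (2 * (2 * n + 1) * x) - 1) -
      (eulerMascheroniConstant - log x)| ≤ x ^ 2 := by
  have hS := ((summable_one_div_exp_sub_one hx).hasSum.tendsto_sum_nat).const_mul (4 * x)
  have hq : Tendsto (fun N : ℕ => exp (-(4 * x)) ^ N) atTop (𝓝 0) :=
    tendsto_pow_atTop_nhds_zero_of_lt_one (exp_pos _).le (exp_lt_one_iff.2 (by linarith))
  have hlog : Tendsto (fun N : ℕ => log (1 - exp (-(4 * x)) ^ N)) atTop (𝓝 0) := by
    simpa using (hq.const_sub 1).log (by norm_num)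
  have hM := (tendsto_sum_odd_sub_log.add hlog).sub_const (2 * log 2 + log x)
  have e : eulerMascheroniConstant + 2 * log 2 + 0 - (2 * log 2 + log x) =
      eulerMascheroniConstant - log x := by ring
  rw [e] at hM
  refine le_of_tendsto (hS.sub hM).abs ?_
  filter_upwards [eventually_gt_atTop 0] with N hN
  refine le_of_eq_of_le (congrArg _ ?_) (abs_sum_langevin_sub_le hx N)
  have hN' : (0 : ℝ) < N := by exact_mod_cast hN
  have hsum : ∑ n ∈ Finset.range N, 1 / (exp (2 * (2 * n + 1) * x) - 1) =
      (∑ n ∈ Finset.range N, langevin ((2 * n + 1) * x) +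
        (∑ n ∈ Finset.range N, 2 / (2 * (n : ℝ) + 1)) / (2 * x) - N) / 2 := by
    have hN1 : (N : ℝ) = ∑ n ∈ Finset.range N, 1 := by simp
    conv_rhs => rw [hN1]
    rw [Finset.sum_div, ← Finset.sum_add_distrib, ← Finset.sum_sub_distrib, Finset.sum_div]
    refine Finset.sum_congr rfl fun n _ => ?_
    rw [mul_assoc, one_div_exp_sub_one_eq (by positivity)]
    field_simp
  have hK : logSinhc (2 * N * x) =
      2 * N * x + log (1 - exp (-(4 * x)) ^ N) - 2 * log 2 - log N - log x := by
    have hlt : exp (-(4 * x)) ^ N < 1 :=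
      pow_lt_one₀ (exp_pos _).le (exp_lt_one_iff.2 (by linarith)) hN.ne'
    have hsinh : sinh (2 * N * x) / (2 * N * x) =
        exp (2 * N * x) * (1 - exp (-(4 * x)) ^ N) / (2 * 2 * N * x) := by
      rw [sinh_eq, ← exp_nat_mul, mul_sub, ← exp_add]
      ring_nf
    rw [logSinhc, hsinh, log_div (mul_pos (exp_pos _) (sub_pos.2 hlt)).ne' (by positivity),
      log_mul (exp_pos _).ne' (sub_pos.2 hlt).ne', log_exp, log_mul (by positivity) hx.ne',
      log_mul (by norm_num) hN'.ne', log_mul two_ne_zero two_ne_zero]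
    ring
  rw [hsum, hK]
  field_simp
  ring

theorem logSinhc_nonneg {u : ℝ} (hu : 0 < u) : 0 ≤ logSinhc u :=
  log_nonneg ((one_le_div hu).2 (self_le_sinh_iff.2 hu.le))

theorem logSinhc_le_cosh_sub_one {u : ℝ} (hu : 0 < u) : logSinhc u ≤ cosh u - 1 := by
  have hs := sinh_pos_iff.2 hu
  refine (log_le_sub_one_of_pos (div_pos hs hu)).trans (sub_le_sub_right ?_ 1)
  rw [div_le_iff₀ hu, mul_comm]
  exact sinh_le_self_mul_cosh hu.le

section Sphere

variable {r ε : ℝ}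

theorem alphaTilde_pos (hr : 0 < r) (hε : 0 < ε) : 0 < alphaTilde r ε :=
  sqrt_pos.2 (by positivity)

theorem alphaTilde_sq (hr : 0 < r) (hε : 0 < ε) : alphaTilde r ε ^ 2 = ε * (r + ε / 4) :=
  sq_sqrt (by positivity)

theorem xi0_pos (hr : 0 < r) (hε : 0 < ε) : 0 < xi0 r ε :=
  arsinh_pos_iff.2 (div_pos (alphaTilde_pos hr hε) hr)

theorem sinh_xi0 : sinh (xi0 r ε) = alphaTilde r ε / r := sinh_arsinh _

theorem cosh_xi0 (hr : 0 < r) (hε : 0 < ε) : cosh (xi0 r ε) = 1 + ε / (2 * r) := by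
  rw [← sq_eq_sq₀ (cosh_pos _).le (by positivity), cosh_sq, sinh_xi0, div_pow,
    alphaTilde_sq hr hε]
  field_simp
  ring

theorem sinh_half_xi0 (hr : 0 < r) (hε : 0 < ε) : 2 * sinh (xi0 r ε / 2) = √ε / √r := by
  have hs := sinh_pos_iff.2 (half_pos (xi0_pos hr hε))
  rw [← sq_eq_sq₀ (by positivity) (by positivity), div_pow, sq_sqrt hε.le, sq_sqrt hr.le]
  have h := cosh_two_mul (xi0 r ε / 2)
  rw [mul_div_cancel₀ _ two_ne_zero, cosh_xi0 hr hε, cosh_sq] at h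
  field_simp at h ⊢
  linarith

theorem logSinhc_half_xi0 (hr : 0 < r) (hε : 0 < ε) :
    logSinhc (xi0 r ε / 2) = log √ε - log √r - log (xi0 r ε) := by
  have hξ := xi0_pos hr hε
  have e : sinh (xi0 r ε / 2) / (xi0 r ε / 2) = √ε / √r / xi0 r ε := by
    rw [← sinh_half_xi0 hr hε]
    field_simp
  rw [logSinhc, e, log_div (by positivity) hξ.ne', log_div (by positivity) (by positivity)]

theorem abs_C12sym_add_le (hr : 0 < r) (hε : 0 < ε) :
    |C12sym r ε + 2 * π * (alphaTilde r ε / xi0 r ε) *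
      (eulerMascheroniConstant + log √r - log √ε)| ≤
      2 * π * (r + ε / 4) / r * ε + π * (r + ε / 2) / r * ε := by
  have hξ := xi0_pos hr hε
  have hα := alphaTilde_pos hr hε
  have hS := abs_tsum_one_div_exp_sub_one_sub_le hξ
  have hK0 := logSinhc_nonneg (half_pos hξ)
  have hK1 : logSinhc (xi0 r ε / 2) ≤ ε / (2 * r) := by
    have h1 := logSinhc_le_cosh_sub_one (half_pos hξ)
    have h2 : cosh (xi0 r ε / 2) ≤ cosh (xi0 r ε) := by
      rw [cosh_le_cosh, abs_of_pos hξ, abs_of_pos (half_pos hξ)]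
      linarith
    rw [cosh_xi0 hr hε] at h2
    linarith
  have hξα : xi0 r ε ≤ alphaTilde r ε / r := sinh_xi0 (r := r) ▸ self_le_sinh_iff.2 hξ.le
  have hαξ : alphaTilde r ε / xi0 r ε ≤ r + ε / 2 := by
    have h := sinh_le_self_mul_cosh hξ.le
    rw [sinh_xi0, cosh_xi0 hr hε, div_le_iff₀ hr] at h
    rw [div_le_iff₀ hξ]
    refine h.trans_eq ?_
    field_simp
  have e : C12sym r ε + 2 * π * (alphaTilde r ε / xi0 r ε) *
      (eulerMascheroniConstant + log √r - log √ε) =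
      -(2 * π * (alphaTilde r ε / xi0 r ε) *
        (4 * xi0 r ε * ∑' n : ℕ, 1 / (exp (2 * (2 * n + 1) * xi0 r ε) - 1) -
          (eulerMascheroniConstant - log (xi0 r ε)))) +
      -(2 * π * (alphaTilde r ε / xi0 r ε) * logSinhc (xi0 r ε / 2)) := by
    rw [logSinhc_half_xi0 hr hε, C12sym]
    generalize ∑' n : ℕ, 1 / (exp (2 * (2 * n + 1) * xi0 r ε) - 1) = S
    field_simp
    ring
  have hq : 0 < alphaTilde r ε / xi0 r ε := div_pos hα hξ
  rw [e]
  refine (abs_add_le _ _).trans (add_le_add ?_ ?_)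
  · rw [abs_neg, abs_mul, abs_of_pos (by positivity)]
    calc _ ≤ 2 * π * (alphaTilde r ε / xi0 r ε) * xi0 r ε ^ 2 := by gcongr
      _ = 2 * π * alphaTilde r ε * xi0 r ε := by field_simp
      _ ≤ 2 * π * alphaTilde r ε * (alphaTilde r ε / r) := by gcongr
      _ = 2 * π * alphaTilde r ε ^ 2 / r := by ring
      _ = _ := by rw [alphaTilde_sq hr hε]; ring
  · rw [abs_neg, abs_of_nonneg (by positivity)]
    calc _ ≤ 2 * π * (r + ε / 2) * (ε / (2 * r)) := by gcongr
      _ = _ := by field_simp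

end Sphere

theorem C12_asymptotics (r : ℝ) (hr : 0 < r) :
    (fun ε => C12sym r ε +
        2 * π * (alphaTilde r ε / xi0 r ε) *
          (Real.eulerMascheroniConstant + Real.log (Real.sqrt r) -
            Real.log (Real.sqrt ε)))
      =O[𝓝[>] (0 : ℝ)] (fun ε => ε) := by
  refine Asymptotics.IsBigO.of_bound (2 * π * (r + 1 / 4) / r + π * (r + 1 / 2) / r) ?_
  filter_upwards [Ioo_mem_nhdsGT (zero_lt_one' ℝ)] with ε hε
  have hε0 : 0 < ε := hε.1
  have hε1 : ε ≤ 1 := hε.2.le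
  rw [norm_eq_abs, norm_of_nonneg hε0.le, add_mul]
  refine (abs_C12sym_add_le hr hε0).trans ?_
  gcongr
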